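/- arXiv:0806.3983 — 8 statements merged into one kernel-verified Lean document; each statement's English description precedes it below -/
import Mathlib

section
/- Let (L, η) be a closed localization on a closed symmetric monoidal category 𝒞. If f₁ : X₁ ⟶ Y₁ and f₂ : X₂ ⟶ Y₂ are L-equivalences, then their tensor product f₁ ⊗ f₂ : X₁ ⊗ X₂ ⟶ Y₁ ⊗ Y₂ is an L-equivalence. -/
open CategoryTheory Category MonoidalCategory

theorem aux_isIso_map {C : Type*} [Category C] (L : C ⥤ C) (η : 𝟭 C ⟶ L)
    (hiso : ∀ X : C, IsIso (L.map (η.app X))) {X Y : C} (f : X ⟶ Y)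
    (hs : ∃ u : Y ⟶ L.obj X, f ≫ u = η.app X)
    (hi : ∀ u v : Y ⟶ L.obj Y, f ≫ u = f ≫ v → u = v) : IsIso (L.map f) := by
  obtain ⟨u, hu⟩ := hs
  have hX := hiso X
  have hY := hiso Y
  have nat : f ≫ η.app Y = η.app X ≫ L.map f := η.naturality f
  have h1 : u ≫ L.map f = η.app Y := by
    apply hi
    rw [← assoc, hu]
    exact nat.symm
  refine ⟨L.map u ≫ inv (L.map (η.app X)), ?_, ?_⟩
  · rw [← assoc, ← L.map_comp, hu]
    exact IsIso.hom_inv_id _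
  · have h2 : inv (L.map (η.app X)) ≫ L.map f
        = L.map (L.map f) ≫ inv (L.map (η.app Y)) := by
      rw [IsIso.inv_comp_eq, ← assoc, IsIso.eq_comp_inv]
      have := congrArg L.map nat
      rw [L.map_comp, L.map_comp] at this
      exact this
    rw [assoc, h2, ← assoc, ← L.map_comp, h1]
    exact IsIso.hom_inv_id _

theorem aux_whisker {C : Type*} [Category C] [MonoidalCategory C]
    [MonoidalClosed C] (L : C ⥤ C) (η : 𝟭 C ⟶ L)
    (hiso : ∀ X : C, IsIso (L.map (η.app X)))
    (hclosed : ∀ ⦃X Y : C⦄ (f : X ⟶ Y), IsIso (L.map f) →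
      ∀ Z : C, (∃ W : C, Nonempty (Z ≅ L.obj W)) →
        IsIso ((MonoidalClosed.pre f).app Z))
    {X Y : C} (f : X ⟶ Y) (hf : IsIso (L.map f)) (A : C) :
    IsIso (L.map (f ▷ A)) := by
  apply aux_isIso_map L η hiso
  · have := hclosed f hf (L.obj (X ⊗ A)) ⟨_, ⟨Iso.refl _⟩⟩
    refine ⟨MonoidalClosed.uncurry (MonoidalClosed.curry (η.app (X ⊗ A)) ≫
      inv ((MonoidalClosed.pre f).app (L.obj (X ⊗ A)))), ?_⟩
    apply MonoidalClosed.curry_injective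
    rw [← MonoidalClosed.curry_pre_app, MonoidalClosed.curry_uncurry, assoc,
      IsIso.inv_hom_id, comp_id]
  · intro u v h
    have := hclosed f hf (L.obj (Y ⊗ A)) ⟨_, ⟨Iso.refl _⟩⟩
    apply MonoidalClosed.curry_injective
    rw [← cancel_mono ((MonoidalClosed.pre f).app (L.obj (Y ⊗ A))),
      MonoidalClosed.curry_pre_app, MonoidalClosed.curry_pre_app, h]

/-- For a closed localization `(L, η)` on a closed symmetric monoidal
category, the tensor product of two `L`-equivalences is an `L`-equivalence. -/
theorem tensorHom_isLEquivalence_of_closed_localization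
    {C : Type*} [Category C] [MonoidalCategory C] [SymmetricCategory C]
    [MonoidalClosed C]
    (L : C ⥤ C) (η : 𝟭 C ⟶ L)
    (hη : ∀ X : C, η.app (L.obj X) = L.map (η.app X))
    (hiso : ∀ X : C, IsIso (L.map (η.app X)))
    (hclosed : ∀ ⦃X Y : C⦄ (f : X ⟶ Y), IsIso (L.map f) →
      ∀ Z : C, (∃ W : C, Nonempty (Z ≅ L.obj W)) →
        IsIso ((MonoidalClosed.pre f).app Z))
    {X₁ Y₁ X₂ Y₂ : C} (f₁ : X₁ ⟶ Y₁) (f₂ : X₂ ⟶ Y₂)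
    (h₁ : IsIso (L.map f₁)) (h₂ : IsIso (L.map f₂)) :
    IsIso (L.map (f₁ ⊗ₘ f₂)) := by
  have a := aux_whisker L η hiso hclosed f₁ h₁ X₂
  have b := aux_whisker L η hiso hclosed f₂ h₂ Y₁
  have e : f₁ ⊗ₘ f₂ = f₁ ▷ X₂ ≫ (β_ Y₁ X₂).hom ≫ f₂ ▷ Y₁ ≫ (β_ Y₂ Y₁).hom := by
    rw [MonoidalCategory.tensorHom_def]
    simp
  rw [e, L.map_comp, L.map_comp, L.map_comp]
  infer_instance
end

section
/- Let (L, η) be a closed localization on a closed symmetric monoidal category 𝒞, and let (R, μ, e) be a monoid object in 𝒞. Then there exists a unique monoid object structure (μ', e') on LR such that η_R : R ⟶ LR is a morphism of monoid objects, i.e. such that μ' ∘ (η_R ⊗ η_R) = η_R ∘ μ and e' = η_R ∘ e. -/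
open CategoryTheory Category MonoidalCategory

/-- A monoid object structure on an object `A`: a multiplication `m` and unit `u`
satisfying the unit and associativity axioms. -/
def MonoidAxioms {C : Type*} [Category C] [MonoidalCategory C]
    (A : C) (m : A ⊗ A ⟶ A) (u : 𝟙_ C ⟶ A) : Prop :=
  (u ▷ A) ≫ m = (λ_ A).hom ∧ (A ◁ u) ≫ m = (ρ_ A).hom ∧
    (m ▷ A) ≫ m = (α_ A A A).hom ≫ (A ◁ m) ≫ m


theorem closed_loc_aux
    {C : Type*} [Category C] [MonoidalCategory C] [SymmetricCategory C]
    [MonoidalClosed C] {R A : C} (n : R ⟶ A)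
    (hpre : IsIso ((MonoidalClosed.pre n).app A))
    (μ : R ⊗ R ⟶ R) (e : 𝟙_ C ⟶ R) (hR : MonoidAxioms R μ e) :
    ∃! p : (A ⊗ A ⟶ A) × (𝟙_ C ⟶ A),
      MonoidAxioms A p.1 p.2 ∧
      (n ⊗ₘ n) ≫ p.1 = μ ≫ n ∧
      p.2 = e ≫ n := by
  -- right-whiskered precomposition is bijective
  have injR : ∀ {Y : C} (g h : A ⊗ Y ⟶ A), n ▷ Y ≫ g = n ▷ Y ≫ h → g = h := by
    intro Y g h H
    apply MonoidalClosed.curry_injective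
    rw [← cancel_mono ((MonoidalClosed.pre n).app A), MonoidalClosed.curry_pre_app,
      MonoidalClosed.curry_pre_app, H]
  have surR : ∀ {Y : C} (k : R ⊗ Y ⟶ A), ∃ g : A ⊗ Y ⟶ A, n ▷ Y ≫ g = k := by
    intro Y k
    refine ⟨MonoidalClosed.uncurry (MonoidalClosed.curry k ≫
      inv ((MonoidalClosed.pre n).app A)), ?_⟩
    rw [← MonoidalClosed.uncurry_pre_app, assoc, IsIso.inv_hom_id, comp_id,
      MonoidalClosed.uncurry_curry]
  have injL : ∀ {Y : C} (g h : Y ⊗ A ⟶ A), Y ◁ n ≫ g = Y ◁ n ≫ h → g = h := by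
    intro Y g h H
    rw [← cancel_epi (β_ A Y).hom]
    apply injR
    rw [BraidedCategory.braiding_naturality_left_assoc,
      BraidedCategory.braiding_naturality_left_assoc, H]
  have surL : ∀ {Y : C} (k : Y ⊗ R ⟶ A), ∃ g : Y ⊗ A ⟶ A, Y ◁ n ≫ g = k := by
    intro Y k
    obtain ⟨g, hg⟩ := surR ((β_ R Y).hom ≫ k)
    refine ⟨(β_ Y A).hom ≫ g, ?_⟩
    rw [BraidedCategory.braiding_naturality_right_assoc, hg,
      SymmetricCategory.symmetry_assoc]
  have injRR : ∀ {Y Z : C} (g h : (A ⊗ Y) ⊗ Z ⟶ A),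
      n ▷ Y ▷ Z ≫ g = n ▷ Y ▷ Z ≫ h → g = h := by
    intro Y Z g h H
    rw [← cancel_epi (α_ A Y Z).inv]
    apply injR
    rw [associator_inv_naturality_left_assoc, associator_inv_naturality_left_assoc, H]
  have injLR : ∀ {Y Z : C} (g h : (Y ⊗ A) ⊗ Z ⟶ A),
      (Y ◁ n) ▷ Z ≫ g = (Y ◁ n) ▷ Z ≫ h → g = h := by
    intro Y Z g h H
    rw [← cancel_epi ((β_ A Y).hom ▷ Z)]
    apply injRR
    rw [← comp_whiskerRight_assoc, ← comp_whiskerRight_assoc,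
      BraidedCategory.braiding_naturality_left, comp_whiskerRight_assoc,
      comp_whiskerRight_assoc, H]
  obtain ⟨m₁, hm₁⟩ := surL (μ ≫ n)
  obtain ⟨m, hm⟩ := surR m₁
  have hmul : R ◁ n ≫ n ▷ A ≫ m = μ ≫ n := by rw [hm, hm₁]
  have hmul' : n ▷ R ≫ A ◁ n ≫ m = μ ≫ n := by rw [← hmul, whisker_exchange_assoc]
  obtain ⟨h1, h2, h3⟩ := hR
  refine ⟨(m, e ≫ n), ⟨⟨?_, ?_, ?_⟩, ?_, rfl⟩, ?_⟩
  · apply injL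
    dsimp only
    rw [comp_whiskerRight, assoc, whisker_exchange_assoc, hmul, ← assoc, h1,
      leftUnitor_naturality]
  · apply injR
    dsimp only
    rw [whiskerLeft_comp, assoc, ← whisker_exchange_assoc, hmul', ← assoc, h2,
      rightUnitor_naturality]
  · apply injL
    apply injLR
    apply injRR
    dsimp only
    have lhs : n ▷ R ▷ R ≫ (A ◁ n) ▷ R ≫ (A ⊗ A) ◁ n ≫ m ▷ A ≫ m = μ ▷ R ≫ μ ≫ n := by
      rw [whisker_exchange_assoc, ← comp_whiskerRight_assoc, ← comp_whiskerRight_assoc, assoc,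
        hmul', comp_whiskerRight_assoc, hmul']
    have rhs : n ▷ R ▷ R ≫ (A ◁ n) ▷ R ≫ (A ⊗ A) ◁ n ≫ (α_ A A A).hom ≫ A ◁ m ≫ m
        = (α_ R R R).hom ≫ R ◁ μ ≫ μ ≫ n := by
      rw [associator_naturality_right_assoc, associator_naturality_middle_assoc,
        associator_naturality_left_assoc, ← whiskerLeft_comp_assoc, ← whiskerLeft_comp_assoc,
        assoc, hmul', ← whisker_exchange_assoc, whiskerLeft_comp_assoc, hmul]
    rw [lhs, rhs, ← assoc, h3, assoc, assoc]
  · rw [MonoidalCategory.tensorHom_def, assoc, hmul']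
  · rintro ⟨m', u'⟩ ⟨-, hm', hu'⟩
    dsimp only at hm' hu'
    rw [MonoidalCategory.tensorHom_def, assoc, ← hmul'] at hm'
    rw [hu', injL _ _ (injR _ _ hm')]

/-- For a closed localization `(L, η)` on a closed symmetric monoidal
category and a monoid object `(R, μ, e)`, there is a unique monoid object structure
`(μ', e')` on `LR` making `η_R` a morphism of monoid objects. -/
theorem closed_localization_preserves_monoid_objects
    {C : Type*} [Category C] [MonoidalCategory C] [SymmetricCategory C]
    [MonoidalClosed C]
    (L : C ⥤ C) (η : 𝟭 C ⟶ L)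
    (hη : ∀ X : C, η.app (L.obj X) = L.map (η.app X))
    (hiso : ∀ X : C, IsIso (L.map (η.app X)))
    (hclosed : ∀ ⦃X Y : C⦄ (f : X ⟶ Y), IsIso (L.map f) →
      ∀ Z : C, (∃ W : C, Nonempty (Z ≅ L.obj W)) →
        IsIso ((MonoidalClosed.pre f).app Z))
    (R : C) (μ : R ⊗ R ⟶ R) (e : 𝟙_ C ⟶ R) (hR : MonoidAxioms R μ e) :
    ∃! p : (L.obj R ⊗ L.obj R ⟶ L.obj R) × (𝟙_ C ⟶ L.obj R),
      MonoidAxioms (L.obj R) p.1 p.2 ∧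
      (η.app R ⊗ₘ η.app R) ≫ p.1 = μ ≫ η.app R ∧
      p.2 = e ≫ η.app R := by
  exact closed_loc_aux (η.app R)
    (hclosed _ (hiso R) _ ⟨R, ⟨Iso.refl _⟩⟩) μ e hR
end

section
/- Let (L, η) be a closed localization on a closed symmetric monoidal category 𝒞, and let (R, μ, e) be a commutative monoid object in 𝒞, i.e. a monoid object with μ ∘ β_{R,R} = μ where β is the braiding. Then the unique monoid object structure (μ', e') on LR for which η_R : R ⟶ LR is a morphism of monoid objects is itself commutative: μ' ∘ β_{LR,LR} = μ'. -/
open CategoryTheory Category MonoidalCategory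

theorem cancel_whisker_aux {C : Type*} [Category C] [MonoidalCategory C]
    [MonoidalClosed C] {X Y Z W : C} (f : X ⟶ Y) (hf : IsIso ((MonoidalClosed.pre f).app Z))
    (g h : Y ⊗ W ⟶ Z) (hgh : f ▷ W ≫ g = f ▷ W ≫ h) : g = h := by
  apply MonoidalClosed.curry_injective
  rw [← cancel_mono ((MonoidalClosed.pre f).app Z), MonoidalClosed.curry_pre_app,
    MonoidalClosed.curry_pre_app, hgh]

/-- For a closed localization `(L, η)` on a closed symmetric monoidal
category and a commutative monoid object `(R, μ, e)`, the unique monoid structure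
`(μ', e')` on `LR` making `η_R` a monoid morphism is itself commutative. -/
theorem closed_localization_preserves_commutative_monoid_objects
    {C : Type*} [Category C] [MonoidalCategory C] [SymmetricCategory C]
    [MonoidalClosed C]
    (L : C ⥤ C) (η : 𝟭 C ⟶ L)
    (hη : ∀ X : C, η.app (L.obj X) = L.map (η.app X))
    (hiso : ∀ X : C, IsIso (L.map (η.app X)))
    (hclosed : ∀ ⦃X Y : C⦄ (f : X ⟶ Y), IsIso (L.map f) →
      ∀ Z : C, (∃ W : C, Nonempty (Z ≅ L.obj W)) →
        IsIso ((MonoidalClosed.pre f).app Z))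
    (R : C) (μ : R ⊗ R ⟶ R) (e : 𝟙_ C ⟶ R) (hR : MonoidAxioms R μ e)
    (hcomm : (β_ R R).hom ≫ μ = μ)
    (μ' : L.obj R ⊗ L.obj R ⟶ L.obj R) (e' : 𝟙_ C ⟶ L.obj R)
    (hLR : MonoidAxioms (L.obj R) μ' e')
    (hμ' : (η.app R ⊗ₘ η.app R) ≫ μ' = μ ≫ η.app R)
    (he' : e' = e ≫ η.app R) :
    (β_ (L.obj R) (L.obj R)).hom ≫ μ' = μ' := by
  have hp := hclosed (η.app R) (hiso R) (L.obj R) ⟨R, ⟨Iso.refl _⟩⟩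
  apply cancel_whisker_aux (η.app R) hp
  rw [← cancel_epi (β_ (L.obj R) ((𝟭 C).obj R)).hom]
  apply cancel_whisker_aux (η.app R) hp
  have key : (η.app R ⊗ₘ η.app R) ≫ (β_ (L.obj R) (L.obj R)).hom ≫ μ' =
      (η.app R ⊗ₘ η.app R) ≫ μ' := by
    rw [← Category.assoc, BraidedCategory.braiding_naturality, Category.assoc, hμ',
      ← Category.assoc]
    exact congrArg (· ≫ η.app R) hcomm
  have e1 : ∀ k : L.obj R ⊗ L.obj R ⟶ L.obj R,
      η.app R ▷ ((𝟭 C).obj R) ≫ (β_ (L.obj R) ((𝟭 C).obj R)).hom ≫ η.app R ▷ L.obj R ≫ k =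
      (β_ ((𝟭 C).obj R) ((𝟭 C).obj R)).hom ≫ (η.app R ⊗ₘ η.app R) ≫ k := by
    intro k
    rw [BraidedCategory.braiding_naturality_left_assoc, tensorHom_def', Category.assoc]
  rw [e1, e1, key]
end

section
/- Let (L, η) be a closed localization on a closed symmetric monoidal category 𝒞, and let f : R₁ ⟶ R₂ be a morphism of monoid objects in 𝒞. Equip LR₁ and LR₂ with monoid object structures such that η_{R₁} : R₁ ⟶ LR₁ and η_{R₂} : R₂ ⟶ LR₂ are morphisms of monoid objects. Then Lf : LR₁ ⟶ LR₂ is a morphism of monoid objects. -/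
open CategoryTheory Category MonoidalCategory

/-- For a closed localization `(L, η)` on a closed symmetric monoidal
category and a morphism of monoid objects `f : R₁ ⟶ R₂`, if `LR₁` and `LR₂` carry
monoid structures making `η_{R₁}` and `η_{R₂}` monoid morphisms, then `Lf` is a
morphism of monoid objects. -/
theorem closed_localization_preserves_monoid_morphisms
    {C : Type*} [Category C] [MonoidalCategory C] [SymmetricCategory C]
    [MonoidalClosed C]
    (L : C ⥤ C) (η : 𝟭 C ⟶ L)
    (hη : ∀ X : C, η.app (L.obj X) = L.map (η.app X))
    (hiso : ∀ X : C, IsIso (L.map (η.app X)))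
    (hclosed : ∀ ⦃X Y : C⦄ (f : X ⟶ Y), IsIso (L.map f) →
      ∀ Z : C, (∃ W : C, Nonempty (Z ≅ L.obj W)) →
        IsIso ((MonoidalClosed.pre f).app Z))
    (R₁ R₂ : C) (μ₁ : R₁ ⊗ R₁ ⟶ R₁) (e₁ : 𝟙_ C ⟶ R₁)
    (μ₂ : R₂ ⊗ R₂ ⟶ R₂) (e₂ : 𝟙_ C ⟶ R₂)
    (hR₁ : MonoidAxioms R₁ μ₁ e₁) (hR₂ : MonoidAxioms R₂ μ₂ e₂)
    (f : R₁ ⟶ R₂) (hfμ : μ₁ ≫ f = (f ⊗ₘ f) ≫ μ₂) (hfe : e₁ ≫ f = e₂)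
    (μ₁' : L.obj R₁ ⊗ L.obj R₁ ⟶ L.obj R₁) (e₁' : 𝟙_ C ⟶ L.obj R₁)
    (μ₂' : L.obj R₂ ⊗ L.obj R₂ ⟶ L.obj R₂) (e₂' : 𝟙_ C ⟶ L.obj R₂)
    (hLR₁ : MonoidAxioms (L.obj R₁) μ₁' e₁')
    (hLR₂ : MonoidAxioms (L.obj R₂) μ₂' e₂')
    (hημ₁ : (η.app R₁ ⊗ₘ η.app R₁) ≫ μ₁' = μ₁ ≫ η.app R₁)
    (hηe₁ : e₁' = e₁ ≫ η.app R₁)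
    (hημ₂ : (η.app R₂ ⊗ₘ η.app R₂) ≫ μ₂' = μ₂ ≫ η.app R₂)
    (hηe₂ : e₂' = e₂ ≫ η.app R₂) :
    μ₁' ≫ L.map f = (L.map f ⊗ₘ L.map f) ≫ μ₂' ∧ e₁' ≫ L.map f = e₂' := by
  have hr : ∀ {X Y : C} (g : X ⟶ Y), IsIso (L.map g) → ∀ (A W : C)
      (a b : Y ⊗ A ⟶ L.obj W), g ▷ A ≫ a = g ▷ A ≫ b → a = b := by
    intro X Y g hg A W a b h
    have := hclosed g hg (L.obj W) ⟨W, ⟨Iso.refl _⟩⟩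
    apply MonoidalClosed.curry_injective
    rw [← cancel_mono ((MonoidalClosed.pre g).app (L.obj W)),
      MonoidalClosed.curry_pre_app, MonoidalClosed.curry_pre_app, h]
  have hl : ∀ {X Y : C} (g : X ⟶ Y), IsIso (L.map g) → ∀ (A W : C)
      (a b : A ⊗ Y ⟶ L.obj W), A ◁ g ≫ a = A ◁ g ≫ b → a = b := by
    intro X Y g hg A W a b h
    rw [← cancel_epi (β_ Y A).hom]
    apply hr g hg
    rw [BraidedCategory.braiding_naturality_left_assoc,
      BraidedCategory.braiding_naturality_left_assoc, h]
  have nat : η.app R₁ ≫ L.map f = f ≫ η.app R₂ := (η.naturality f).symm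
  constructor
  · apply hr (η.app R₁) (hiso R₁)
    apply hl (η.app R₁) (hiso R₁)
    have e : ∀ t : L.obj R₁ ⊗ L.obj R₁ ⟶ L.obj R₂,
        (R₁ ◁ η.app R₁ ≫ η.app R₁ ▷ L.obj R₁ ≫ t) = (η.app R₁ ⊗ₘ η.app R₁) ≫ t := by
      intro t
      rw [MonoidalCategory.tensorHom_def']
      exact (Category.assoc _ _ _).symm
    refine (e _).trans (Eq.trans ?_ (e _).symm)
    rw [← Category.assoc, hημ₁, Category.assoc, nat, ← Category.assoc, hfμ, Category.assoc,
      ← hημ₂, ← Category.assoc, ← Category.assoc]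
    congr 1
    refine (MonoidalCategory.tensorHom_comp_tensorHom _ _ _ _).trans
      (Eq.trans ?_ (MonoidalCategory.tensorHom_comp_tensorHom _ _ _ _).symm)
    rw [nat]
  · rw [hηe₁, hηe₂, Category.assoc, nat, ← Category.assoc, hfe]
end

section
/- Let (L, η) be a closed localization on a closed symmetric monoidal category 𝒞, let (R, μ, e) be a monoid object in 𝒞, and let (M, a) be a left R-module with action a : R ⊗ M ⟶ M. Equip LR with the monoid object structure for which η_R : R ⟶ LR is a morphism of monoid objects. Then there exists a unique left LR-module structure a'' : LR ⊗ LM ⟶ LM on LM such that a'' ∘ (η_R ⊗ η_M) = η_M ∘ a; this structure extends the induced R-module structure on LM. -/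
open CategoryTheory Category MonoidalCategory

/-- A left module structure over a monoid object `(A, m, u)`: an action
`a : A ⊗ M ⟶ M` satisfying the unit and associativity axioms. -/
def LeftModuleAxioms {C : Type*} [Category C] [MonoidalCategory C]
    {A : C} (m : A ⊗ A ⟶ A) (u : 𝟙_ C ⟶ A) (M : C) (a : A ⊗ M ⟶ M) : Prop :=
  (u ▷ M) ≫ a = (λ_ M).hom ∧
    (m ▷ M) ≫ a = (α_ A A M).hom ≫ (A ◁ a) ≫ a

theorem closedLoc_bij {C : Type*} [Category C] [MonoidalCategory C]
    [MonoidalClosed C] {X Y : C} (f : X ⟶ Y) (Z : C)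
    (h : IsIso ((MonoidalClosed.pre f).app Z)) (W : C) :
    (∀ g₁ g₂ : Y ⊗ W ⟶ Z, f ▷ W ≫ g₁ = f ▷ W ≫ g₂ → g₁ = g₂) ∧
    (∀ k : X ⊗ W ⟶ Z, ∃ g : Y ⊗ W ⟶ Z, f ▷ W ≫ g = k) := by
  constructor
  · intro g₁ g₂ hg
    apply MonoidalClosed.curry_injective
    rw [← cancel_mono ((MonoidalClosed.pre f).app Z), MonoidalClosed.curry_pre_app,
      MonoidalClosed.curry_pre_app, hg]
  · intro k
    refine ⟨MonoidalClosed.uncurry (MonoidalClosed.curry k ≫ inv ((MonoidalClosed.pre f).app Z)), ?_⟩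
    apply MonoidalClosed.curry_injective
    rw [← MonoidalClosed.curry_pre_app, MonoidalClosed.curry_uncurry, assoc, IsIso.inv_hom_id,
      comp_id]

theorem closedLoc_inj_left {C : Type*} [Category C] [MonoidalCategory C] [SymmetricCategory C]
    [MonoidalClosed C] {X Y : C} (f : X ⟶ Y) (Z : C)
    (h : IsIso ((MonoidalClosed.pre f).app Z)) (W : C)
    (g₁ g₂ : W ⊗ Y ⟶ Z) (hg : W ◁ f ≫ g₁ = W ◁ f ≫ g₂) : g₁ = g₂ := by
  rw [← cancel_epi (β_ Y W).hom]
  apply (closedLoc_bij f Z h W).1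
  rw [BraidedCategory.braiding_naturality_left_assoc,
    BraidedCategory.braiding_naturality_left_assoc, hg]

/-- For a closed localization `(L, η)`, a monoid object `(R, μ, e)` and
a left `R`-module `(M, a)`, equipping `LR` with the monoid structure for which `η_R`
is a monoid morphism, there is a unique left `LR`-module structure `a''` on `LM`
with `a'' ∘ (η_R ⊗ η_M) = η_M ∘ a`, and it extends the induced `R`-module structure
`a'` on `LM`. -/
theorem closed_localization_left_module_over_localized_monoid
    {C : Type*} [Category C] [MonoidalCategory C] [SymmetricCategory C]
    [MonoidalClosed C]
    (L : C ⥤ C) (η : 𝟭 C ⟶ L)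
    (hη : ∀ X : C, η.app (L.obj X) = L.map (η.app X))
    (hiso : ∀ X : C, IsIso (L.map (η.app X)))
    (hclosed : ∀ ⦃X Y : C⦄ (f : X ⟶ Y), IsIso (L.map f) →
      ∀ Z : C, (∃ W : C, Nonempty (Z ≅ L.obj W)) →
        IsIso ((MonoidalClosed.pre f).app Z))
    (R : C) (μ : R ⊗ R ⟶ R) (e : 𝟙_ C ⟶ R) (hR : MonoidAxioms R μ e)
    (M : C) (a : R ⊗ M ⟶ M) (hM : LeftModuleAxioms μ e M a)
    (μ' : L.obj R ⊗ L.obj R ⟶ L.obj R) (e' : 𝟙_ C ⟶ L.obj R)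
    (hLR : MonoidAxioms (L.obj R) μ' e')
    (hημ : (η.app R ⊗ₘ η.app R) ≫ μ' = μ ≫ η.app R)
    (hηe : e' = e ≫ η.app R)
    (a' : R ⊗ L.obj M ⟶ L.obj M)
    (hLM : LeftModuleAxioms μ e (L.obj M) a')
    (ha' : (R ◁ η.app M) ≫ a' = a ≫ η.app M) :
    (∃! a'' : L.obj R ⊗ L.obj M ⟶ L.obj M,
        LeftModuleAxioms μ' e' (L.obj M) a'' ∧
        (η.app R ⊗ₘ η.app M) ≫ a'' = a ≫ η.app M) ∧
    (∀ a'' : L.obj R ⊗ L.obj M ⟶ L.obj M,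
        LeftModuleAxioms μ' e' (L.obj M) a'' →
        (η.app R ⊗ₘ η.app M) ≫ a'' = a ≫ η.app M →
        (η.app R ▷ L.obj M) ≫ a'' = a') := by
  have hpre : ∀ X : C, IsIso ((MonoidalClosed.pre (η.app X)).app (L.obj M)) := fun X =>
    hclosed (η.app X) (hiso X) _ ⟨M, ⟨Iso.refl _⟩⟩
  have injR : ∀ (X W : C) (g₁ g₂ : L.obj X ⊗ W ⟶ L.obj M),
      η.app X ▷ W ≫ g₁ = η.app X ▷ W ≫ g₂ → g₁ = g₂ := fun X W =>
    (closedLoc_bij (η.app X) _ (hpre X) W).1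
  have injL : ∀ (X W : C) (g₁ g₂ : W ⊗ L.obj X ⟶ L.obj M),
      W ◁ η.app X ≫ g₁ = W ◁ η.app X ≫ g₂ → g₁ = g₂ := fun X W =>
    closedLoc_inj_left (η.app X) _ (hpre X) W
  have ext : ∀ a'' : L.obj R ⊗ L.obj M ⟶ L.obj M,
      (η.app R ⊗ₘ η.app M) ≫ a'' = a ≫ η.app M → (η.app R ▷ L.obj M) ≫ a'' = a' := by
    intro a'' h
    apply injL M R
    rw [ha', ← h, tensorHom_def', assoc]
    rfl
  refine ⟨?_, fun a'' _ h => ext a'' h⟩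
  obtain ⟨a'', h''⟩ := (closedLoc_bij (η.app R) _ (hpre R) (L.obj M)).2 a'
  refine ⟨a'', ⟨⟨?_, ?_⟩, ?_⟩, ?_⟩
  · rw [hηe, comp_whiskerRight, assoc]
    exact (congrArg _ h'').trans hLM.1
  · have h3 : η.app R ▷ L.obj M ≫ a'' = a' := h''
    rw [← cancel_epi (α_ (L.obj R) (L.obj R) (L.obj M)).inv]
    apply injR R
    rw [← cancel_epi (α_ R (L.obj R) (L.obj M)).hom]
    rw [← cancel_epi ((β_ (L.obj R) R).hom ▷ L.obj M)]
    rw [← cancel_epi (α_ (L.obj R) R (L.obj M)).inv]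
    apply injR R
    have hn : η.app R ▷ (R ⊗ L.obj M) ≫ (α_ (L.obj R) R (L.obj M)).inv ≫
        (β_ (L.obj R) R).hom ▷ L.obj M ≫ (α_ R (L.obj R) (L.obj M)).hom ≫
        η.app R ▷ (L.obj R ⊗ L.obj M) ≫ (α_ (L.obj R) (L.obj R) (L.obj M)).inv =
        (α_ R R (L.obj M)).inv ≫ (β_ R R).hom ▷ L.obj M ≫
          ((η.app R ⊗ₘ η.app R) ▷ L.obj M) := by
      have h1 : η.app R ▷ R ≫ (β_ (L.obj R) R).hom = (β_ R R).hom ≫ R ◁ η.app R :=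
        BraidedCategory.braiding_naturality_left _ _
      have h2 : η.app R ▷ (L.obj R ⊗ L.obj M) ≫ (α_ (L.obj R) (L.obj R) (L.obj M)).inv =
          (α_ R (L.obj R) (L.obj M)).inv ≫ (η.app R ▷ L.obj R) ▷ L.obj M :=
        associator_inv_naturality_left _ _ _
      have h4 : η.app R ▷ (R ⊗ L.obj M) ≫ (α_ (L.obj R) R (L.obj M)).inv =
          (α_ R R (L.obj M)).inv ≫ (η.app R ▷ R) ▷ L.obj M :=
        associator_inv_naturality_left _ _ _
      rw [h2, Iso.hom_inv_id_assoc, reassoc_of% h4, ← comp_whiskerRight_assoc, h1,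
        tensorHom_def', comp_whiskerRight, comp_whiskerRight, assoc]
      rfl
    have key : ((η.app R ⊗ₘ η.app R) ▷ L.obj M) ≫ μ' ▷ L.obj M ≫ a'' =
        ((η.app R ⊗ₘ η.app R) ▷ L.obj M) ≫
          (α_ (L.obj R) (L.obj R) (L.obj M)).hom ≫ (L.obj R ◁ a'') ≫ a'' := by
      rw [← comp_whiskerRight_assoc, hημ, comp_whiskerRight, assoc]
      refine (congrArg _ h3).trans (hLM.2.trans ?_)
      have h5 : (η.app R ⊗ₘ η.app R) ▷ L.obj M ≫ (α_ (L.obj R) (L.obj R) (L.obj M)).hom =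
          (α_ R R (L.obj M)).hom ≫ R ◁ (η.app R ▷ L.obj M) ≫ η.app R ▷ (L.obj R ⊗ L.obj M) := by
        rw [tensorHom_def']
        simp
      have h6 : η.app R ▷ (L.obj R ⊗ L.obj M) ≫ L.obj R ◁ a'' =
          R ◁ a'' ≫ η.app R ▷ L.obj M := (whisker_exchange _ _).symm
      rw [reassoc_of% h5, reassoc_of% h6]
      rw [h3, ← whiskerLeft_comp_assoc, h3]
    have := congrArg (fun t => (α_ R R (L.obj M)).inv ≫ (β_ R R).hom ▷ L.obj M ≫ t) key
    have hn' := fun {T : C} (t : _ ⟶ T) => congrArg (· ≫ t) hn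
    simp only [assoc] at hn'
    refine (hn' _).trans (this.trans (hn' _).symm)
  · rw [tensorHom_def', assoc]
    exact (congrArg _ h'').trans ha'
  · rintro b ⟨_, hb⟩
    apply injR R
    exact (ext b hb).trans h''.symm
end

section
/- Let (L, η) be a closed localization on a closed symmetric monoidal category 𝒞, let R and S be monoid objects in 𝒞, and let M be an R-S-bimodule with left action l : R ⊗ M ⟶ M and right action r : M ⊗ S ⟶ M. Equip LR and LS with the monoid object structures for which η_R and η_S are morphisms of monoid objects. Then there exists a unique LR-LS-bimodule structure (l'', r'') on LM such that l'' ∘ (η_R ⊗ η_M) = η_M ∘ l and r'' ∘ (η_M ⊗ η_S) = η_M ∘ r. -/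
open CategoryTheory Category MonoidalCategory

/-- A right module structure over a monoid object `(A, m, u)`. -/
def RightModuleAxioms {C : Type*} [Category C] [MonoidalCategory C]
    {A : C} (m : A ⊗ A ⟶ A) (u : 𝟙_ C ⟶ A) (M : C) (r : M ⊗ A ⟶ M) : Prop :=
  (M ◁ u) ≫ r = (ρ_ M).hom ∧
    (r ▷ A) ≫ r = (α_ M A A).hom ≫ (M ◁ m) ≫ r

/-- An `R`-`S`-bimodule structure: a left `R`-action and a right `S`-action that
commute with each other. -/
def BimoduleAxioms {C : Type*} [Category C] [MonoidalCategory C]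
    {R S : C} (μR : R ⊗ R ⟶ R) (eR : 𝟙_ C ⟶ R)
    (μS : S ⊗ S ⟶ S) (eS : 𝟙_ C ⟶ S)
    (M : C) (l : R ⊗ M ⟶ M) (r : M ⊗ S ⟶ M) : Prop :=
  LeftModuleAxioms μR eR M l ∧ RightModuleAxioms μS eS M r ∧
    (l ▷ S) ≫ r = (α_ R M S).hom ≫ (R ◁ r) ≫ l

/-- Precomposition with `f ▷ A` into `Z` is bijective for all `A`. -/
def TensorOrth {C : Type*} [Category C] [MonoidalCategory C] (Z : C) {X Y : C} (f : X ⟶ Y) : Prop :=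
  ∀ A : C, Function.Bijective (fun g : Y ⊗ A ⟶ Z => f ▷ A ≫ g)

section helpers

variable {C : Type*} [Category C] [MonoidalCategory C] {Z : C}

theorem bij_of_iso_conj {X Y X' Y' : C} {f : X ⟶ Y} {f' : X' ⟶ Y'} (a : X ≅ X') (b : Y ≅ Y')
    (h : f ≫ b.hom = a.hom ≫ f') (hf : Function.Bijective (fun g : Y ⟶ Z => f ≫ g)) :
    Function.Bijective (fun g : Y' ⟶ Z => f' ≫ g) := by
  have h' : f' = a.inv ≫ f ≫ b.hom := by rw [h, Iso.inv_hom_id_assoc]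
  subst h'
  constructor
  · intro g₁ g₂ e
    have e' : f ≫ (b.hom ≫ g₁) = f ≫ (b.hom ≫ g₂) := by
      simpa using e
    exact (cancel_epi b.hom).1 (hf.1 e')
  · intro k
    obtain ⟨g, hg⟩ := hf.2 (a.hom ≫ k)
    refine ⟨b.inv ≫ g, ?_⟩
    dsimp only at hg
    simp [hg]

theorem TensorOrth.bij {X Y : C} {f : X ⟶ Y} (h : TensorOrth Z f) :
    Function.Bijective (fun g : Y ⟶ Z => f ≫ g) :=
  bij_of_iso_conj (ρ_ X) (ρ_ Y) (by simp) (h (𝟙_ C))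

theorem TensorOrth.cancel {X Y : C} {f : X ⟶ Y} (h : TensorOrth Z f) {g₁ g₂ : Y ⟶ Z}
    (e : f ≫ g₁ = f ≫ g₂) : g₁ = g₂ := h.bij.1 e

theorem TensorOrth.comp {X Y W : C} {f : X ⟶ Y} {g : Y ⟶ W} (hf : TensorOrth Z f)
    (hg : TensorOrth Z g) : TensorOrth Z (f ≫ g) := by
  intro A
  have := (hf A).comp (hg A)
  convert this using 1
  ext k
  simp

theorem TensorOrth.whiskerRight {X Y : C} {f : X ⟶ Y} (h : TensorOrth Z f) (A : C) :
    TensorOrth Z (f ▷ A) := fun B =>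
  bij_of_iso_conj (α_ X A B).symm (α_ Y A B).symm (by simp) (h (A ⊗ B))

theorem TensorOrth.whiskerLeft [BraidedCategory C] {X Y : C} {f : X ⟶ Y} (h : TensorOrth Z f)
    (A : C) : TensorOrth Z (A ◁ f) := fun B =>
  bij_of_iso_conj (whiskerRightIso (β_ X A) B) (whiskerRightIso (β_ Y A) B)
    (by
      simp only [whiskerRightIso_hom, ← comp_whiskerRight, BraidedCategory.braiding_naturality_left]) ((h.whiskerRight A) B)

theorem TensorOrth.tensor [BraidedCategory C] {X Y X' Y' : C} {f : X ⟶ Y} {g : X' ⟶ Y'}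
    (hf : TensorOrth Z f) (hg : TensorOrth Z g) : TensorOrth Z (f ⊗ₘ g) := by
  rw [MonoidalCategory.tensorHom_def]
  exact (hf.whiskerRight _).comp (hg.whiskerLeft _)

theorem tensorOrth_of_pre [MonoidalClosed C] {X Y : C} (f : X ⟶ Y)
    (h : IsIso ((MonoidalClosed.pre f).app Z)) : TensorOrth Z f := by
  intro A
  constructor
  · intro g₁ g₂ e
    apply MonoidalClosed.curry_injective
    rw [← cancel_mono ((MonoidalClosed.pre f).app Z), MonoidalClosed.curry_pre_app,
      MonoidalClosed.curry_pre_app]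
    exact congrArg _ e
  · intro k
    refine ⟨MonoidalClosed.uncurry (MonoidalClosed.curry k ≫ inv ((MonoidalClosed.pre f).app Z)), ?_⟩
    apply MonoidalClosed.curry_injective
    dsimp only
    rw [← MonoidalClosed.curry_pre_app]
    simp

end helpers

/-- For a closed localization `(L, η)`, monoid objects `R`, `S`, and an
`R`-`S`-bimodule `(M, l, r)`, equipping `LR` and `LS` with the monoid structures for
which `η_R` and `η_S` are monoid morphisms, there is a unique `LR`-`LS`-bimodule
structure `(l'', r'')` on `LM` with `l'' ∘ (η_R ⊗ η_M) = η_M ∘ l` and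
`r'' ∘ (η_M ⊗ η_S) = η_M ∘ r`. -/
theorem closed_localization_bimodule_over_localized_monoids
    {C : Type*} [Category C] [MonoidalCategory C] [SymmetricCategory C]
    [MonoidalClosed C]
    (L : C ⥤ C) (η : 𝟭 C ⟶ L)
    (hη : ∀ X : C, η.app (L.obj X) = L.map (η.app X))
    (hiso : ∀ X : C, IsIso (L.map (η.app X)))
    (hclosed : ∀ ⦃X Y : C⦄ (f : X ⟶ Y), IsIso (L.map f) →
      ∀ Z : C, (∃ W : C, Nonempty (Z ≅ L.obj W)) →
        IsIso ((MonoidalClosed.pre f).app Z))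
    (R S : C) (μR : R ⊗ R ⟶ R) (eR : 𝟙_ C ⟶ R)
    (μS : S ⊗ S ⟶ S) (eS : 𝟙_ C ⟶ S)
    (hR : MonoidAxioms R μR eR) (hS : MonoidAxioms S μS eS)
    (M : C) (l : R ⊗ M ⟶ M) (r : M ⊗ S ⟶ M)
    (hM : BimoduleAxioms μR eR μS eS M l r)
    (μR' : L.obj R ⊗ L.obj R ⟶ L.obj R) (eR' : 𝟙_ C ⟶ L.obj R)
    (hLR : MonoidAxioms (L.obj R) μR' eR')
    (hημR : (η.app R ⊗ₘ η.app R) ≫ μR' = μR ≫ η.app R)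
    (hηeR : eR' = eR ≫ η.app R)
    (μS' : L.obj S ⊗ L.obj S ⟶ L.obj S) (eS' : 𝟙_ C ⟶ L.obj S)
    (hLS : MonoidAxioms (L.obj S) μS' eS')
    (hημS : (η.app S ⊗ₘ η.app S) ≫ μS' = μS ≫ η.app S)
    (hηeS : eS' = eS ≫ η.app S) :
    ∃! q : (L.obj R ⊗ L.obj M ⟶ L.obj M) × (L.obj M ⊗ L.obj S ⟶ L.obj M),
      BimoduleAxioms μR' eR' μS' eS' (L.obj M) q.1 q.2 ∧
      (η.app R ⊗ₘ η.app M) ≫ q.1 = l ≫ η.app M ∧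
      (η.app M ⊗ₘ η.app S) ≫ q.2 = r ≫ η.app M := by
  have hO : ∀ X : C, TensorOrth (L.obj M) (η.app X) := fun X =>
    tensorOrth_of_pre _ (hclosed _ (hiso X) _ ⟨M, ⟨Iso.refl _⟩⟩)
  obtain ⟨⟨hl1, hl2⟩, ⟨hr1, hr2⟩, hlr⟩ := hM
  obtain ⟨l', hl'⟩ := ((hO R).tensor (hO M)).bij.2 (l ≫ η.app M)
  obtain ⟨r', hr'⟩ := ((hO M).tensor (hO S)).bij.2 (r ≫ η.app M)
  dsimp only at hl' hr'
  refine ⟨(l', r'), ⟨⟨⟨?_, ?_⟩, ⟨?_, ?_⟩, ?_⟩, hl', hr'⟩, ?_⟩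
  · apply ((hO M).whiskerLeft (𝟙_ C)).cancel
    calc 𝟙_ C ◁ η.app M ≫ eR' ▷ L.obj M ≫ l'
        = eR ▷ M ≫ (η.app R ⊗ₘ η.app M) ≫ l' := by
          subst hηeR
          simp only [MonoidalCategory.tensorHom_def, comp_whiskerRight, whiskerLeft_comp, assoc,
            whisker_exchange_assoc, Functor.id_obj]
      _ = _ := by
          rw [hl', reassoc_of% hl1]
          simp
  · apply (((hO R).tensor (hO R)).tensor (hO M)).cancel
    calc ((η.app R ⊗ₘ η.app R) ⊗ₘ η.app M) ≫ μR' ▷ L.obj M ≫ l'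
        = (((η.app R ⊗ₘ η.app R) ≫ μR') ⊗ₘ η.app M) ≫ l' := by
          simp only [MonoidalCategory.tensorHom_def, comp_whiskerRight, whiskerLeft_comp, assoc,
            whisker_exchange_assoc, Functor.id_obj]
      _ = μR ▷ M ≫ (η.app R ⊗ₘ η.app M) ≫ l' := by
          rw [hημR]; simp [MonoidalCategory.tensorHom_def]
      _ = (α_ R R M).hom ≫ R ◁ l ≫ (η.app R ⊗ₘ η.app M) ≫ l' := by
          rw [hl', reassoc_of% hl2]
      _ = (α_ R R M).hom ≫ (η.app R ⊗ₘ (l ≫ η.app M)) ≫ l' := by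
          simp only [MonoidalCategory.tensorHom_def, comp_whiskerRight, whiskerLeft_comp, assoc,
            whisker_exchange_assoc, Functor.id_obj]
      _ = (α_ R R M).hom ≫ (η.app R ⊗ₘ ((η.app R ⊗ₘ η.app M) ≫ l')) ≫ l' := by
          rw [hl']
      _ = (α_ R R M).hom ≫ (η.app R ⊗ₘ (η.app R ⊗ₘ η.app M)) ≫ L.obj R ◁ l' ≫ l' := by
          simp only [MonoidalCategory.tensorHom_def, whiskerLeft_comp, assoc]
      _ = _ := by rw [← associator_naturality_assoc]
  · apply ((hO M).whiskerRight (𝟙_ C)).cancel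
    calc η.app M ▷ 𝟙_ C ≫ L.obj M ◁ eS' ≫ r'
        = M ◁ eS ≫ (η.app M ⊗ₘ η.app S) ≫ r' := by
          subst hηeS
          simp only [MonoidalCategory.tensorHom_def, comp_whiskerRight, whiskerLeft_comp, assoc,
            whisker_exchange_assoc, Functor.id_obj]
      _ = _ := by
          rw [hr', reassoc_of% hr1]
          simp
  · apply (((hO M).tensor (hO S)).tensor (hO S)).cancel
    calc ((η.app M ⊗ₘ η.app S) ⊗ₘ η.app S) ≫ r' ▷ L.obj S ≫ r'
        = (((η.app M ⊗ₘ η.app S) ≫ r') ⊗ₘ η.app S) ≫ r' := by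
          simp only [MonoidalCategory.tensorHom_def, comp_whiskerRight, whiskerLeft_comp, assoc,
            whisker_exchange_assoc, Functor.id_obj]
      _ = r ▷ S ≫ (η.app M ⊗ₘ η.app S) ≫ r' := by
          refine (congrArg (fun t => (t ⊗ₘ η.app S) ≫ r') hr').trans ?_
          simp [MonoidalCategory.tensorHom_def]
      _ = (α_ M S S).hom ≫ M ◁ μS ≫ (η.app M ⊗ₘ η.app S) ≫ r' := by
          rw [hr', reassoc_of% hr2]
      _ = (α_ M S S).hom ≫ (η.app M ⊗ₘ (μS ≫ η.app S)) ≫ r' := by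
          simp only [MonoidalCategory.tensorHom_def, comp_whiskerRight, whiskerLeft_comp, assoc,
            whisker_exchange_assoc, Functor.id_obj]
      _ = (α_ M S S).hom ≫ (η.app M ⊗ₘ ((η.app S ⊗ₘ η.app S) ≫ μS')) ≫ r' := by
          rw [hημS]
      _ = (α_ M S S).hom ≫ (η.app M ⊗ₘ (η.app S ⊗ₘ η.app S)) ≫ L.obj M ◁ μS' ≫ r' := by
          simp only [MonoidalCategory.tensorHom_def, whiskerLeft_comp, assoc]
      _ = _ := by rw [← associator_naturality_assoc]
  · apply (((hO R).tensor (hO M)).tensor (hO S)).cancel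
    calc ((η.app R ⊗ₘ η.app M) ⊗ₘ η.app S) ≫ l' ▷ L.obj S ≫ r'
        = (((η.app R ⊗ₘ η.app M) ≫ l') ⊗ₘ η.app S) ≫ r' := by
          simp only [MonoidalCategory.tensorHom_def, comp_whiskerRight, whiskerLeft_comp, assoc,
            whisker_exchange_assoc, Functor.id_obj]
      _ = l ▷ S ≫ (η.app M ⊗ₘ η.app S) ≫ r' := by
          rw [hl']; simp [MonoidalCategory.tensorHom_def]
      _ = (α_ R M S).hom ≫ R ◁ r ≫ (η.app R ⊗ₘ η.app M) ≫ l' := by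
          rw [hr', hl', reassoc_of% hlr]
      _ = (α_ R M S).hom ≫ (η.app R ⊗ₘ (r ≫ η.app M)) ≫ l' := by
          simp only [MonoidalCategory.tensorHom_def, comp_whiskerRight, whiskerLeft_comp, assoc,
            whisker_exchange_assoc, Functor.id_obj]
      _ = (α_ R M S).hom ≫ (η.app R ⊗ₘ ((η.app M ⊗ₘ η.app S) ≫ r')) ≫ l' := by
          rw [hr']
      _ = (α_ R M S).hom ≫ (η.app R ⊗ₘ (η.app M ⊗ₘ η.app S)) ≫ L.obj R ◁ r' ≫ l' := by
          simp only [MonoidalCategory.tensorHom_def, whiskerLeft_comp, assoc]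
      _ = _ := by rw [← associator_naturality_assoc]
  · rintro ⟨l₂, r₂⟩ ⟨-, h1, h2⟩
    exact Prod.ext (((hO R).tensor (hO M)).cancel (h1.trans hl'.symm))
      (((hO M).tensor (hO S)).cancel (h2.trans hr'.symm))
end

section
/- Let (L, η) be a closed localization on a closed symmetric monoidal category 𝒞, let R be a monoid object in 𝒞, and let f : M₁ ⟶ M₂ be a morphism of left R-modules with actions a₁ and a₂. Equip LR with the monoid object structure for which η_R is a morphism of monoid objects, and equip LM₁ and LM₂ with left LR-module structures a₁'' and a₂'' satisfying a₁'' ∘ (η_R ⊗ η_{M₁}) = η_{M₁} ∘ a₁ and a₂'' ∘ (η_R ⊗ η_{M₂}) = η_{M₂} ∘ a₂. Then Lf : LM₁ ⟶ LM₂ is a morphism of left LR-modules. -/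
open CategoryTheory Category MonoidalCategory

/-- Maps into a local object are determined after whiskering an `L`-equivalence on the right. -/
theorem whisker_cancel_aux {C : Type*} [Category C] [MonoidalCategory C]
    [MonoidalClosed C] {X X' Y Z : C} (f : X ⟶ X')
    (hf : IsIso ((MonoidalClosed.pre f).app Z)) (g h : X' ⊗ Y ⟶ Z)
    (H : f ▷ Y ≫ g = f ▷ Y ≫ h) : g = h := by
  have key : ∀ k : X' ⊗ Y ⟶ Z,
      MonoidalClosed.uncurry (MonoidalClosed.curry k ≫ (MonoidalClosed.pre f).app Z)
        = f ▷ Y ≫ k := by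
    intro k
    rw [MonoidalClosed.uncurry_natural_left, MonoidalClosed.uncurry_pre,
      whisker_exchange_assoc, ← MonoidalClosed.uncurry_eq, MonoidalClosed.uncurry_curry]
  apply MonoidalClosed.curry_injective
  rw [← cancel_mono ((MonoidalClosed.pre f).app Z)]
  apply MonoidalClosed.uncurry_injective
  rw [key, key, H]

/-- For a closed localization `(L, η)`, a monoid object `R`, and a
morphism of left `R`-modules `f : M₁ ⟶ M₂`, equipping `LR` with the monoid structure
for which `η_R` is a monoid morphism, and `LM₁`, `LM₂` with the left `LR`-module
structures `a₁''`, `a₂''` satisfying the stated compatibilities, `Lf` is a morphism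
of left `LR`-modules. -/
theorem closed_localization_module_morphism_over_localized_monoid
    {C : Type*} [Category C] [MonoidalCategory C] [SymmetricCategory C]
    [MonoidalClosed C]
    (L : C ⥤ C) (η : 𝟭 C ⟶ L)
    (hη : ∀ X : C, η.app (L.obj X) = L.map (η.app X))
    (hiso : ∀ X : C, IsIso (L.map (η.app X)))
    (hclosed : ∀ ⦃X Y : C⦄ (f : X ⟶ Y), IsIso (L.map f) →
      ∀ Z : C, (∃ W : C, Nonempty (Z ≅ L.obj W)) →
        IsIso ((MonoidalClosed.pre f).app Z))
    (R : C) (μ : R ⊗ R ⟶ R) (e : 𝟙_ C ⟶ R) (hR : MonoidAxioms R μ e)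
    (M₁ M₂ : C) (a₁ : R ⊗ M₁ ⟶ M₁) (a₂ : R ⊗ M₂ ⟶ M₂)
    (hM₁ : LeftModuleAxioms μ e M₁ a₁) (hM₂ : LeftModuleAxioms μ e M₂ a₂)
    (f : M₁ ⟶ M₂) (hf : a₁ ≫ f = (R ◁ f) ≫ a₂)
    (μ' : L.obj R ⊗ L.obj R ⟶ L.obj R) (e' : 𝟙_ C ⟶ L.obj R)
    (hLR : MonoidAxioms (L.obj R) μ' e')
    (hημ : (η.app R ⊗ₘ η.app R) ≫ μ' = μ ≫ η.app R)
    (hηe : e' = e ≫ η.app R)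
    (a₁'' : L.obj R ⊗ L.obj M₁ ⟶ L.obj M₁) (a₂'' : L.obj R ⊗ L.obj M₂ ⟶ L.obj M₂)
    (hLM₁ : LeftModuleAxioms μ' e' (L.obj M₁) a₁'')
    (hLM₂ : LeftModuleAxioms μ' e' (L.obj M₂) a₂'')
    (hηa₁ : (η.app R ⊗ₘ η.app M₁) ≫ a₁'' = a₁ ≫ η.app M₁)
    (hηa₂ : (η.app R ⊗ₘ η.app M₂) ≫ a₂'' = a₂ ≫ η.app M₂) :
    a₁'' ≫ L.map f = (L.obj R ◁ L.map f) ≫ a₂'' := by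
  have hZ : ∃ W : C, Nonempty (L.obj M₂ ≅ L.obj W) := ⟨M₂, ⟨Iso.refl _⟩⟩
  have hnat : f ≫ η.app M₂ = η.app M₁ ≫ L.map f := η.naturality f
  apply whisker_cancel_aux (η.app R) (hclosed _ (hiso R) _ hZ)
  rw [← cancel_epi (β_ (L.obj M₁) R).hom]
  apply whisker_cancel_aux (η.app M₁) (hclosed _ (hiso M₁) _ hZ)
  have sw : ∀ k : L.obj R ⊗ L.obj M₁ ⟶ L.obj M₂,
      η.app M₁ ▷ R ≫ (β_ (L.obj M₁) R).hom ≫ η.app R ▷ L.obj M₁ ≫ k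
        = (β_ M₁ R).hom ≫ (η.app R ⊗ₘ η.app M₁) ≫ k := by
    intro k
    have h1 : η.app M₁ ▷ R ≫ (β_ (L.obj M₁) R).hom = (β_ M₁ R).hom ≫ R ◁ η.app M₁ :=
      BraidedCategory.braiding_naturality_left (η.app M₁) R
    have h2 : (η.app R ⊗ₘ η.app M₁) = R ◁ η.app M₁ ≫ η.app R ▷ L.obj M₁ :=
      MonoidalCategory.tensorHom_def' _ _
    rw [reassoc_of% h1, h2, assoc]
  refine (sw _).trans (Eq.trans ?_ (sw _).symm)
  congr 1
  have h3 : (η.app R ⊗ₘ η.app M₁) ≫ L.obj R ◁ L.map f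
      = R ◁ f ≫ (η.app R ⊗ₘ η.app M₂) := by
    rw [← id_tensorHom, ← id_tensorHom, tensorHom_comp_tensorHom]
    refine Eq.trans ?_ (tensorHom_comp_tensorHom _ _ _ _).symm
    rw [hnat, comp_id]
    congr 1
    exact (id_comp _).symm
  have h4 : (η.app R ⊗ₘ η.app M₁) ≫ a₁'' ≫ L.map f = a₁ ≫ η.app M₁ ≫ L.map f := by
    rw [← assoc, hηa₁, assoc]
  have h5 : (η.app R ⊗ₘ η.app M₁) ≫ L.obj R ◁ L.map f ≫ a₂''
      = R ◁ f ≫ a₂ ≫ η.app M₂ := by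
    rw [← assoc, h3, assoc, hηa₂]
  have h6 : a₁ ≫ η.app M₁ ≫ L.map f = R ◁ f ≫ a₂ ≫ η.app M₂ := by
    rw [← hnat, ← assoc, hf, assoc]
  exact h4.trans (h6.trans h5.symm)
end

section
/- Let (L, η) be a localization on the category Ab of abelian groups, and let (R, μ, e) be a monoid object in Ab (i.e. an associative unital ring). Then there exists a unique monoid object structure (μ', e') on LR such that η_R : R ⟶ LR is a morphism of monoid objects; moreover, if R is commutative (μ ∘ β_{R,R} = μ for the braiding β), then this monoid structure on LR is commutative. -/
open CategoryTheory Category MonoidalCategory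

/-- The linear extension operator along `h`. -/
theorem exists_ext_mul {k R S : Type} [CommRing k] [AddCommGroup R] [Module k R] [AddCommGroup S] [Module k S]
    (h : R →ₗ[k] S)
    (hex : ∀ g : R →ₗ[k] S, ∃ g' : S →ₗ[k] S, ∀ r, g' (h r) = g r)
    (hun : ∀ f g : S →ₗ[k] S, (∀ r, f (h r) = g (h r)) → f = g)
    (M : R →ₗ[k] R →ₗ[k] R) :
    ∃ K : S →ₗ[k] S →ₗ[k] S, ∀ r s, K (h r) (h s) = h (M r s) := by
  let P : (S →ₗ[k] S) →ₗ[k] (R →ₗ[k] S) := LinearMap.lcomp k S h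
  have hP : Function.Bijective P := by
    constructor
    · intro f g hfg
      exact hun f g fun r => LinearMap.congr_fun hfg r
    · intro g
      obtain ⟨g', hg'⟩ := hex g
      exact ⟨g', LinearMap.ext hg'⟩
  let E := (LinearEquiv.ofBijective P hP).symm
  have hE : ∀ g r, E g (h r) = g r := fun g r =>
    LinearMap.congr_fun ((LinearEquiv.ofBijective P hP).apply_symm_apply g) r
  let N : R →ₗ[k] (S →ₗ[k] S) := E.toLinearMap ∘ₗ (M.compr₂ h).flip
  refine ⟨E.toLinearMap ∘ₗ N.flip, fun r s => ?_⟩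
  simp [hE, N]

theorem ext_two {k R S : Type} [CommRing k] [AddCommGroup R] [Module k R] [AddCommGroup S] [Module k S]
    (h : R →ₗ[k] S)
    (hun : ∀ f g : S →ₗ[k] S, (∀ r, f (h r) = g (h r)) → f = g)
    (K K' : S →ₗ[k] S →ₗ[k] S) (hK : ∀ r s, K (h r) (h s) = K' (h r) (h s)) : K = K' := by
  have h1 : ∀ r, K (h r) = K' (h r) := fun r => hun _ _ (hK r)
  ext x y
  exact LinearMap.congr_fun (hun (K.flip y) (K'.flip y) fun r => by simp [h1]) x

theorem ext_three {k R S : Type} [CommRing k] [AddCommGroup R] [Module k R] [AddCommGroup S] [Module k S]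
    (h : R →ₗ[k] S)
    (hun : ∀ f g : S →ₗ[k] S, (∀ r, f (h r) = g (h r)) → f = g)
    (K : S →ₗ[k] S →ₗ[k] S)
    (hK : ∀ r s t, K (K (h r) (h s)) (h t) = K (h r) (K (h s) (h t))) (x y z : S) :
    K (K x y) z = K x (K y z) := by
  have h1 : ∀ r s, ∀ z, K (K (h r) (h s)) z = K (h r) (K (h s) z) := fun r s z =>
    LinearMap.congr_fun (hun (K (K (h r) (h s))) (K (h r) ∘ₗ K (h s)) (hK r s)) z
  have h2 : K.flip z ∘ₗ (K.flip y) = K.flip (K y z) := by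
    apply hun
    intro r
    exact LinearMap.congr_fun (hun (K.flip z ∘ₗ K (h r)) (K (h r) ∘ₗ K.flip z)
      fun s => h1 r s z) y
  exact LinearMap.congr_fun h2 x



theorem main_aux {k : Type} [CommRing k] (R S : ModuleCat.{0} k) (h : R ⟶ S)
    (hex : ∀ g : R ⟶ S, ∃ g' : S ⟶ S, h ≫ g' = g)
    (hun : ∀ f g : S ⟶ S, h ≫ f = h ≫ g → f = g)
    (μ : R ⊗ R ⟶ R) (e : 𝟙_ (ModuleCat k) ⟶ R)
    (hR : MonoidAxioms R μ e) :
    (∃! p : (S ⊗ S ⟶ S) × (𝟙_ (ModuleCat k) ⟶ S),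
        MonoidAxioms S p.1 p.2 ∧
        (h ⊗ₘ h) ≫ p.1 = μ ≫ h ∧
        p.2 = e ≫ h) ∧
    ((β_ R R).hom ≫ μ = μ →
      ∀ (μ' : S ⊗ S ⟶ S) (e' : 𝟙_ (ModuleCat k) ⟶ S),
        MonoidAxioms S μ' e' →
        (h ⊗ₘ h) ≫ μ' = μ ≫ h →
        e' = e ≫ h →
        (β_ S S).hom ≫ μ' = μ') := by
  have hex' : ∀ g : R →ₗ[k] S, ∃ g' : S →ₗ[k] S, ∀ r, g' (h.hom r) = g r := by
    intro g
    obtain ⟨g', hg⟩ := hex (ModuleCat.ofHom g)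
    exact ⟨g'.hom, fun r => LinearMap.congr_fun (congrArg ModuleCat.Hom.hom hg) r⟩
  have hun' : ∀ f g : S →ₗ[k] S, (∀ r, f (h.hom r) = g (h.hom r)) → f = g := by
    intro f g hfg
    have := hun (ModuleCat.ofHom f) (ModuleCat.ofHom g) (by ext r; exact hfg r)
    exact congrArg ModuleCat.Hom.hom this
  let cur : ∀ {A : ModuleCat k}, (A ⊗ A ⟶ A) → (A →ₗ[k] A →ₗ[k] A) :=
    fun m => TensorProduct.curry m.hom
  have hcur : ∀ {A : ModuleCat k} (m m' : A ⊗ A ⟶ A), cur m = cur m' → m = m' := by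
    intro A m m' hm
    exact ModuleCat.hom_ext (TensorProduct.curry_injective hm)
  have hcomp : ∀ (m' : S ⊗ S ⟶ S), (h ⊗ₘ h) ≫ m' = μ ≫ h →
      ∀ r s, cur m' (h.hom r) (h.hom s) = h.hom (cur μ r s) := by
    intro m' hm r s
    exact LinearMap.congr_fun (congrArg ModuleCat.Hom.hom hm) (r ⊗ₜ[k] s)
  obtain ⟨hR1, hR2, hR3⟩ := hR
  have e1 : ∀ r, cur μ (e.hom (1:k)) r = r := fun r => by
    have := LinearMap.congr_fun (congrArg ModuleCat.Hom.hom hR1) ((1:k) ⊗ₜ[k] r)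
    exact this.trans (one_smul k r)
  have e2 : ∀ r, cur μ r (e.hom (1:k)) = r := fun r => by
    have := LinearMap.congr_fun (congrArg ModuleCat.Hom.hom hR2) (r ⊗ₜ[k] (1:k))
    exact this.trans (one_smul k r)
  have e3 : ∀ r s t, cur μ (cur μ r s) t = cur μ r (cur μ s t) := fun r s t =>
    LinearMap.congr_fun (congrArg ModuleCat.Hom.hom hR3) ((r ⊗ₜ[k] s) ⊗ₜ[k] t)
  refine ⟨?_, ?_⟩
  · obtain ⟨K, hK⟩ := exists_ext_mul h.hom hex' hun' (cur μ)
    refine ⟨⟨ModuleCat.ofHom (TensorProduct.lift K), e ≫ h⟩, ⟨⟨?_, ?_, ?_⟩, ?_, rfl⟩, ?_⟩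
    · have key : K (h.hom (e.hom (1:k))) = LinearMap.id :=
        hun' _ _ fun r => by rw [hK, e1]; rfl
      apply ModuleCat.hom_ext
      refine TensorProduct.ext ?_
      refine LinearMap.ext_ring ?_
      refine LinearMap.ext fun x => ?_
      exact (LinearMap.congr_fun key x).trans (one_smul k x).symm
    · have key : K.flip (h.hom (e.hom (1:k))) = LinearMap.id :=
        hun' _ _ fun r => by rw [LinearMap.flip_apply, hK, e2]; rfl
      apply ModuleCat.hom_ext
      refine TensorProduct.ext ?_
      refine LinearMap.ext fun x => ?_
      refine LinearMap.ext_ring ?_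
      exact (LinearMap.congr_fun key x).trans (one_smul k x).symm
    · apply ModuleCat.hom_ext
      refine TensorProduct.ext_threefold fun x y z => ?_
      exact ext_three h.hom hun' K (fun r s t => by rw [hK, hK, hK, hK, e3]) x y z
    · apply ModuleCat.hom_ext
      refine TensorProduct.ext' fun x y => ?_
      exact hK x y
    · rintro ⟨m, u⟩ ⟨-, hm, hu⟩
      refine Prod.ext (hcur _ _ ?_) hu
      refine ext_two h.hom hun' _ _ fun r s => ?_
      exact (hcomp m hm r s).trans (hK r s).symm
  · intro hβ m u _ hm _
    have hc : ∀ r s, cur μ s r = cur μ r s := fun r s =>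
      LinearMap.congr_fun (congrArg ModuleCat.Hom.hom hβ) (r ⊗ₜ[k] s)
    apply hcur
    refine ext_two h.hom hun' _ _ fun r s => ?_
    refine Eq.trans (b := cur m (h.hom s) (h.hom r)) rfl ?_
    rw [hcomp m hm, hcomp m hm, hc]

/-- For a localization `(L, η)` on the category `Ab` of abelian groups
(realized as `ModuleCat ℤ` with the monoidal structure given by `⊗_ℤ`) and a monoid
object `(R, μ, e)` (i.e. an associative unital ring), there is a unique monoid
object structure on `LR` making `η_R` a monoid morphism; moreover, if `R` is
commutative then this monoid structure on `LR` is commutative. -/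
theorem localization_on_ab_preserves_rings
    (L : ModuleCat ℤ ⥤ ModuleCat ℤ) (η : 𝟭 (ModuleCat ℤ) ⟶ L)
    (hη : ∀ X : ModuleCat ℤ, η.app (L.obj X) = L.map (η.app X))
    (hiso : ∀ X : ModuleCat ℤ, IsIso (L.map (η.app X)))
    (R : ModuleCat ℤ) (μ : R ⊗ R ⟶ R) (e : 𝟙_ (ModuleCat ℤ) ⟶ R)
    (hR : MonoidAxioms R μ e) :
    (∃! p : (L.obj R ⊗ L.obj R ⟶ L.obj R) × (𝟙_ (ModuleCat ℤ) ⟶ L.obj R),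
        MonoidAxioms (L.obj R) p.1 p.2 ∧
        (η.app R ⊗ₘ η.app R) ≫ p.1 = μ ≫ η.app R ∧
        p.2 = e ≫ η.app R) ∧
    ((β_ R R).hom ≫ μ = μ →
      ∀ (μ' : L.obj R ⊗ L.obj R ⟶ L.obj R) (e' : 𝟙_ (ModuleCat ℤ) ⟶ L.obj R),
        MonoidAxioms (L.obj R) μ' e' →
        (η.app R ⊗ₘ η.app R) ≫ μ' = μ ≫ η.app R →
        e' = e ≫ η.app R →
        (β_ (L.obj R) (L.obj R)).hom ≫ μ' = μ') := by
  have hex : ∀ g : R ⟶ L.obj R, ∃ g' : L.obj R ⟶ L.obj R, η.app R ≫ g' = g := by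
    intro g
    have := hiso R
    refine ⟨L.map g ≫ inv (L.map (η.app R)), ?_⟩
    have h := η.naturality g
    simp only [Functor.id_map] at h
    rw [← assoc, ← h, IsIso.comp_inv_eq]
    exact congrArg (fun t => g ≫ t) (hη R)
  have hun : ∀ f g : L.obj R ⟶ L.obj R, η.app R ≫ f = η.app R ≫ g → f = g := by
    intro f g hfg
    have := hiso R
    have : IsIso (η.app (L.obj R)) := by rw [hη]; infer_instance
    have h1 := η.naturality f
    have h2 := η.naturality g
    simp only [Functor.id_map] at h1 h2
    rw [← cancel_mono (η.app (L.obj R))]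
    refine h1.trans (Eq.trans ?_ h2.symm)
    rw [hη, ← L.map_comp, ← L.map_comp]
    exact congrArg L.map hfg
  exact main_aux R (L.obj R) (η.app R) hex hun μ e hR
end
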